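/- arXiv:1204.4491 — 7 statements merged into one kernel-verified Lean document; each statement's English description precedes it below -/
import Mathlib

section
/- Let V be a finite type, σ : Finset V → ℝ a monotone submodular set function with σ(∅) = 0, b > 0 a budget, and c : V → ℝ a cost function with 0 < c(v) ≤ b for every v ∈ V. Run the Naive Greedy procedure: initialize S = ∅ and candidate set R = V; while R is nonempty, pick u ∈ R maximizing (σ(S ∪ {u}) − σ(S))/c(u), add u to S if c(S) + c(u) ≤ b, and remove u from R regardless. Let S₁ be the resulting set and let s_max ∈ V be an element maximizing σ({v}) over v ∈ V. Then max(σ(S₁), σ({s_max})) ≥ (1 − 1/√e) · σ(S*) for every set S* ⊆ V with c(S*) ≤ b. (Theorem 2: Improved Greedy is a (1 − 1/√e)-approximation for budgeted influence maximization.) -/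
section SubmodularGreedy

variable {V : Type*} [DecidableEq V]

/-- The gain of adding a set to `S` is at most the sum of the individual gains. -/
theorem submodular_union_le_add_sum (σ : Finset V → ℝ)
    (hmono : ∀ A B : Finset V, A ⊆ B → σ A ≤ σ B)
    (hsub : ∀ A B : Finset V, A ⊆ B → ∀ v ∉ B,
      σ (insert v B) - σ B ≤ σ (insert v A) - σ A) (S U : Finset V) :
    σ (S ∪ U) ≤ σ S + ∑ v ∈ U, (σ (insert v S) - σ S) := by
  induction U using Finset.induction_on with
  | empty => simp
  | insert v U hv ih =>
    rw [Finset.sum_insert hv, Finset.union_insert]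
    by_cases hmem : v ∈ S ∪ U
    · rw [Finset.insert_eq_of_mem hmem]
      linarith [hmono S (insert v S) (Finset.subset_insert v S)]
    · linarith [hsub S (S ∪ U) Finset.subset_union_left v hmem]

/-- The first `n` steps of the naive greedy procedure for the spread `σ`, costs `c` and budget `b`:
`u j` is the element examined at step `j`, `S j` the seed set and `R j` the candidate set. -/
structure IsGreedyRun (σ : Finset V → ℝ) (b : ℝ) (c : V → ℝ) (n : ℕ)
    (u : ℕ → V) (S R : ℕ → Finset V) : Prop where
  pick : ∀ j < n, u j ∈ R j ∧ ∀ v ∈ R j,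
    (σ (insert v (S j)) - σ (S j)) / c v ≤ (σ (insert (u j) (S j)) - σ (S j)) / c (u j)
  seed_step : ∀ j < n, S (j + 1) =
    if (∑ v ∈ S j, c v) + c (u j) ≤ b then insert (u j) (S j) else S j
  candidate_step : ∀ j < n, R (j + 1) = (R j).erase (u j)

namespace IsGreedyRun

variable {σ : Finset V → ℝ} {b : ℝ} {c : V → ℝ} {n : ℕ} {u : ℕ → V} {S R : ℕ → Finset V}

theorem seed_subset (h : IsGreedyRun σ b c n u S R) {i : ℕ} (hi : i ≤ n) : S i ⊆ S n := by
  induction n, hi using Nat.le_induction with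
  | base => exact subset_rfl
  | succ m _ ih =>
    refine (ih ⟨fun j hj => h.pick j (by omega), fun j hj => h.seed_step j (by omega),
      fun j hj => h.candidate_step j (by omega)⟩).trans ?_
    rw [h.seed_step m (Nat.lt_succ_self m)]
    split_ifs
    · exact Finset.subset_insert _ _
    · exact subset_rfl

theorem card_candidates (h : IsGreedyRun σ b c n u S R) {j : ℕ} (hj : j ≤ n) :
    (R j).card + j = (R 0).card := by
  induction j with
  | zero => simp
  | succ j ih =>
    have hmem := (h.pick j hj).1
    have hpos := Finset.card_pos.mpr ⟨_, hmem⟩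
    rw [h.candidate_step j hj, Finset.card_erase_of_mem hmem, ← ih (by omega)]
    omega

/-- Either all of `T` is selected from step `i` on, or there is a first step rejecting an element
of `T` because of the budget. -/
theorem subset_or_exists_rejected (h : IsGreedyRun σ b c n u S R) (hR : R n = ∅)
    {T : Finset V} {i : ℕ} (hi : i ≤ n) (hT : T ⊆ S i ∪ R i) :
    T ⊆ S n ∨ ∃ j, i ≤ j ∧ j < n ∧ u j ∈ T ∧ b < (∑ v ∈ S j, c v) + c (u j) ∧
      ∀ k, i ≤ k → k ≤ j → T ⊆ S k ∪ R k := by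
  by_cases hall : ∀ k, i ≤ k → k ≤ n → T ⊆ S k ∪ R k
  · left
    simpa [hR] using hall n hi le_rfl
  · right
    push Not at hall
    classical
    obtain ⟨hik, hkn, hnot⟩ := Nat.find_spec hall
    have hmin : ∀ m < Nat.find hall, i ≤ m → m ≤ n → T ⊆ S m ∪ R m := by
      intro m hm him hmn
      by_contra hcon
      exact Nat.find_min hall hm ⟨him, hmn, hcon⟩
    generalize Nat.find hall = k at hik hkn hnot hmin
    have hne : k ≠ i := by
      rintro rfl
      exact hnot hT
    obtain ⟨j, rfl⟩ : ∃ j, k = j + 1 := ⟨k - 1, by omega⟩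
    have hTj := hmin j (by omega) (by omega) (by omega)
    obtain ⟨w, hwT, hw⟩ := Finset.not_subset.mp hnot
    have hwj := hTj hwT
    rw [h.seed_step j hkn, h.candidate_step j hkn] at hw
    refine ⟨j, by omega, by omega, ?_, ?_, fun m h₁ h₂ => hmin m (by omega) h₁ (by omega)⟩
    · split_ifs at hw <;> simp at hw hwj <;> grind
    · by_contra hle
      rw [if_pos (not_lt.mp hle)] at hw
      simp at hw hwj
      grind

/-- As long as no element of `T` has been rejected, a greedy step realizes the average density
of the missing part of `T`. -/
theorem gap_mul_cost_le (h : IsGreedyRun σ b c n u S R)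
    (hmono : ∀ A B : Finset V, A ⊆ B → σ A ≤ σ B)
    (hsub : ∀ A B : Finset V, A ⊆ B → ∀ v ∉ B,
      σ (insert v B) - σ B ≤ σ (insert v A) - σ A)
    (hc : ∀ v, 0 < c v) {T : Finset V} {B : ℝ} (hTB : ∑ v ∈ T, c v ≤ B)
    {j : ℕ} (hj : j < n) (hT : T ⊆ S j ∪ R j) :
    (σ T - σ (S j)) * c (u j) ≤ B * (σ (insert (u j) (S j)) - σ (S j)) := by
  set d := (σ (insert (u j) (S j)) - σ (S j)) / c (u j) with hd
  have hd_mul : d * c (u j) = σ (insert (u j) (S j)) - σ (S j) :=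
    div_mul_cancel₀ _ (hc _).ne'
  have hd_nonneg : 0 ≤ d :=
    div_nonneg (sub_nonneg.mpr (hmono _ _ (Finset.subset_insert _ _))) (hc _).le
  have hgain : ∀ v ∈ T \ S j, σ (insert v (S j)) - σ (S j) ≤ d * c v := by
    intro v hv
    rw [Finset.mem_sdiff] at hv
    have hvR : v ∈ R j := (Finset.mem_union.mp (hT hv.1)).resolve_left hv.2
    exact (div_le_iff₀ (hc v)).mp ((h.pick j hj).2 v hvR)
  have hunion := submodular_union_le_add_sum σ hmono hsub (S j) (T \ S j)
  rw [Finset.union_sdiff_self_eq_union] at hunion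
  have hTU := hmono T (S j ∪ T) Finset.subset_union_right
  have hsum := Finset.sum_le_sum hgain
  rw [← Finset.mul_sum] at hsum
  have hcost : ∑ v ∈ T \ S j, c v ≤ B :=
    (Finset.sum_le_sum_of_subset_of_nonneg Finset.sdiff_subset
      fun v _ _ => (hc v).le).trans hTB
  have hgap : σ T - σ (S j) ≤ d * B := by
    linarith [mul_le_mul_of_nonneg_left hcost hd_nonneg]
  rw [← hd_mul]
  linarith [mul_le_mul_of_nonneg_right hgap (hc (u j)).le]

/-- As long as no element of `T` has been rejected, the gap to `σ T` decays exponentially in the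
cost of the seed set. -/
theorem gap_le_exp_mul_gap (h : IsGreedyRun σ b c n u S R)
    (hmono : ∀ A B : Finset V, A ⊆ B → σ A ≤ σ B)
    (hsub : ∀ A B : Finset V, A ⊆ B → ∀ v ∉ B,
      σ (insert v B) - σ B ≤ σ (insert v A) - σ A)
    (hc : ∀ v, 0 < c v) {T : Finset V} {B : ℝ} (hB : 0 < B) (hTB : ∑ v ∈ T, c v ≤ B)
    {i j : ℕ} (hij : i ≤ j) (hj : j ≤ n) (hT : ∀ k, i ≤ k → k ≤ j → T ⊆ S k ∪ R k) :
    max (σ T - σ (S j)) 0 ≤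
      Real.exp (-(((∑ v ∈ S j, c v) - ∑ v ∈ S i, c v) / B)) * max (σ T - σ (S i)) 0 := by
  induction j, hij using Nat.le_induction with
  | base => simp
  | succ j hij ih =>
    have ih := ih (by omega) fun k h₁ h₂ => hT k h₁ (by omega)
    have hstep := h.seed_step j hj
    by_cases hmem : S (j + 1) = S j
    · rwa [hmem]
    have hins : S (j + 1) = insert (u j) (S j) := by
      split_ifs at hstep
      · exact hstep
      · exact absurd hstep hmem
    have hnot : u j ∉ S j := fun hu => hmem (by rw [hins, Finset.insert_eq_of_mem hu])
    have hdens := h.gap_mul_cost_le hmono hsub hc hTB hj (hT j hij (by omega))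
    have hle := hmono (S j) (insert (u j) (S j)) (Finset.subset_insert _ _)
    rw [hins, Finset.sum_insert hnot]
    have hexp : Real.exp (-((c (u j) + ∑ v ∈ S j, c v - ∑ v ∈ S i, c v) / B)) =
        Real.exp (-(c (u j) / B)) *
          Real.exp (-(((∑ v ∈ S j, c v) - ∑ v ∈ S i, c v) / B)) := by
      rw [← Real.exp_add]
      congr 1
      ring
    rw [hexp, mul_assoc]
    refine le_trans ?_ (mul_le_mul_of_nonneg_left ih (Real.exp_pos _).le)
    have hexp_ge : 1 - c (u j) / B ≤ Real.exp (-(c (u j) / B)) := by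
      linarith [Real.add_one_le_exp (-(c (u j) / B))]
    refine max_le ?_ (by positivity)
    rcases le_total (σ T - σ (S j)) 0 with hneg | hpos
    · rw [max_eq_right hneg]
      linarith
    · rw [max_eq_left hpos]
      have hdiv : (σ T - σ (S j)) * (c (u j) / B) ≤ σ (insert (u j) (S j)) - σ (S j) := by
        rw [← mul_div_assoc, div_le_iff₀ hB]
        linarith
      linarith [mul_le_mul_of_nonneg_right hexp_ge hpos]

end IsGreedyRun

end SubmodularGreedy

theorem one_sub_le_two_phase_bound {a z : ℝ} (ha : 4 / 7 ≤ a) (hz₀ : 0 ≤ z) (hz₁ : z ≤ 1) :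
    1 - a ≤ (1 - z ^ 4) * a + (z ^ 4 - a * z ^ 3) := by
  have h₃ : z ^ 3 ≤ 1 := pow_le_one₀ hz₀ hz₁
  have h₄ : z ^ 4 ≤ 1 := pow_le_one₀ hz₀ hz₁
  have hfac : 0 ≤ (1 - z) ^ 2 * (1 + 2 * z + 3 * z ^ 2) := by positivity
  nlinarith [mul_nonneg (sub_nonneg.mpr ha) (by linarith : 0 ≤ 2 - z ^ 4 - z ^ 3)]

theorem four_sevenths_le_exp_neg_half : (4 / 7 : ℝ) ≤ Real.exp (-(1 / 2)) := by
  have hsq : Real.exp (-(1 / 2)) ^ 2 * Real.exp 1 = 1 := by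
    rw [← Real.exp_nat_mul, ← Real.exp_add]
    norm_num
  by_contra! hlt
  have hpos := Real.exp_pos (-(1 / 2))
  have hlt_sq : Real.exp (-(1 / 2)) ^ 2 < (4 / 7) ^ 2 := pow_lt_pow_left₀ hlt hpos.le two_ne_zero
  nlinarith [Real.exp_one_lt_d9, Real.exp_pos 1]

theorem one_div_sqrt_exp_one : 1 / √(Real.exp 1) = Real.exp (-(1 / 2)) := by
  rw [← Real.exp_half, Real.exp_neg, one_div]


/-- Theorem 2: Improved Greedy is a `(1 − 1/√e)`-approximation for budgeted
influence maximization.  The Naive Greedy execution is described by the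
sequence `u j` of elements examined at each step `j`, together with the seed
sets `S j` and the remaining candidate sets `R j`: at step `j` the element
`u j ∈ R j` maximizes the marginal-spread-to-cost ratio over `R j`, is added to
the seed set exactly when it fits the remaining budget, and is removed from
`R j`.  After `n = |V|` steps the greedy output is `S₁ = S n`.  Together with
the best singleton `s_max`, the better of the two solutions achieves at least
`(1 − 1/√e)` of the spread of any feasible set `S*`. -/
theorem improved_greedy_approximation
    {V : Type*} [Fintype V] [DecidableEq V]
    (σ : Finset V → ℝ)
    (hmono : ∀ A B : Finset V, A ⊆ B → σ A ≤ σ B)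
    (hsub : ∀ A B : Finset V, A ⊆ B → ∀ v ∉ B,
      σ (insert v B) - σ B ≤ σ (insert v A) - σ A)
    (hempty : σ ∅ = 0)
    (b : ℝ) (hb : 0 < b)
    (c : V → ℝ) (hc : ∀ v : V, 0 < c v ∧ c v ≤ b)
    (n : ℕ) (hn : n = Fintype.card V)
    (u : ℕ → V) (S R : ℕ → Finset V)
    (hS0 : S 0 = ∅) (hR0 : R 0 = Finset.univ)
    (hpick : ∀ j < n, u j ∈ R j ∧ ∀ v ∈ R j,
      (σ (insert v (S j)) - σ (S j)) / c v
        ≤ (σ (insert (u j) (S j)) - σ (S j)) / c (u j))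
    (hSstep : ∀ j < n, S (j + 1) =
      if (∑ v ∈ S j, c v) + c (u j) ≤ b then insert (u j) (S j) else S j)
    (hRstep : ∀ j < n, R (j + 1) = (R j).erase (u j))
    (S₁ : Finset V) (hS₁ : S₁ = S n)
    (smax : V) (hsmax : ∀ v : V, σ {v} ≤ σ {smax})
    (Sstar : Finset V) (hSstar : ∑ v ∈ Sstar, c v ≤ b) :
    (1 - 1 / Real.sqrt (Real.exp 1)) * σ Sstar ≤ max (σ S₁) (σ {smax}) := by
  have hrun : IsGreedyRun σ b c n u S R := ⟨hpick, hSstep, hRstep⟩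
  have hcpos : ∀ v, 0 < c v := fun v => (hc v).1
  have hRn : R n = ∅ := by
    have hcard := hrun.card_candidates le_rfl
    rw [hR0, Finset.card_univ, ← hn] at hcard
    exact Finset.card_eq_zero.mp (by omega)
  rw [hS₁, one_div_sqrt_exp_one]
  set a := Real.exp (-(1 / 2)) with ha_def
  have ha := four_sevenths_le_exp_neg_half
  rw [← ha_def] at ha
  have hOPT : 0 ≤ σ Sstar := hempty ▸ hmono ∅ Sstar (Finset.empty_subset _)
  have hgreedy : ∀ j ≤ n, σ (S j) ≤ max (σ (S n)) (σ {smax}) := fun j hj =>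
    (hmono _ _ (hrun.seed_subset hj)).trans (le_max_left _ _)
  have hstart : Sstar ⊆ S 0 ∪ R 0 := by simp [hS0, hR0]
  rcases hrun.subset_or_exists_rejected hRn n.zero_le hstart with
    hsel | ⟨j, -, hjn, hjT, hjb, hjk⟩
  · nlinarith [hmono _ _ hsel, hgreedy n le_rfl]
  have hgap := hrun.gap_le_exp_mul_gap hmono hsub hcpos hb hSstar j.zero_le hjn.le hjk
  simp only [hS0, hempty, Finset.sum_empty, sub_zero, max_eq_left hOPT] at hgap
  have hgap := (le_max_left _ _).trans hgap
  set s := ∑ v ∈ S j, c v with hs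
  rcases le_total (b / 2) s with hlarge | hsmall
  · have hexp : Real.exp (-(s / b)) ≤ a := by
      apply Real.exp_le_exp.mpr
      have : 1 / 2 ≤ s / b := by rw [le_div_iff₀ hb]; linarith
      linarith
    nlinarith [hgreedy j hjn.le]
  by_cases hsingle : (1 - a) * σ Sstar ≤ σ {u j}
  · exact hsingle.trans ((hsmax _).trans (le_max_right _ _))
  push Not at hsingle
  set T := Sstar.erase (u j) with hT
  have hσT : a * σ Sstar ≤ σ T := by
    have hmarg := hsub ∅ T (Finset.empty_subset _) (u j) (Finset.notMem_erase _ _)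
    rw [hT, Finset.insert_erase hjT, ← hT, hempty, insert_empty_eq] at hmarg
    linarith
  have hcT : ∑ v ∈ T, c v + c (u j) ≤ b := by
    rw [hT, Finset.sum_erase_add _ _ hjT]
    exact hSstar
  have hTj : T ⊆ S j ∪ R j := (Finset.erase_subset _ _).trans (hjk j j.zero_le le_rfl)
  rcases hrun.subset_or_exists_rejected hRn hjn.le hTj with
    hsel | ⟨k, hjk', hkn, hkT, hkb, hkk⟩
  · nlinarith [hmono _ _ hsel, hgreedy n le_rfl]
  have hck : c (u k) ≤ ∑ v ∈ T, c v := Finset.single_le_sum (fun v _ => (hcpos v).le) hkT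
  have hgapT := hrun.gap_le_exp_mul_gap hmono hsub hcpos (half_pos hb) (by linarith)
    hjk' hkn.le hkk
  have hgapT := (le_max_left _ _).trans hgapT
  rw [← hs] at hgapT
  rcases le_total (σ T) (σ (S j)) with hle | hle
  · nlinarith [hgreedy j hjn.le]
  rw [max_eq_left (sub_nonneg.mpr hle)] at hgapT
  set z := Real.exp (-(1 / 2 - s / b)) with hz
  have hz₁ : z ≤ 1 := by
    apply Real.exp_le_one_iff.mpr
    have : s / b ≤ 1 / 2 := by rw [div_le_iff₀ hb]; linarith
    linarith
  have hexpk : Real.exp (-(((∑ v ∈ S k, c v) - s) / (b / 2))) ≤ z ^ 4 := by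
    rw [hz, ← Real.exp_nat_mul]
    apply Real.exp_le_exp.mpr
    have hrate : (b - 2 * s) / (b / 2) ≤ ((∑ v ∈ S k, c v) - s) / (b / 2) :=
      div_le_div_of_nonneg_right (by linarith) (half_pos hb).le
    have heq : (b - 2 * s) / (b / 2) = 4 * (1 / 2 - s / b) := by
      field_simp
      ring
    push_cast
    linarith
  have hexpj : Real.exp (-(s / b)) * z = a := by
    rw [hz, ← Real.exp_add]
    congr 1
    ring
  have hz₀ : 0 ≤ z := (Real.exp_pos _).le
  have hz₄ : z ^ 4 ≤ 1 := pow_le_one₀ hz₀ hz₁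
  have hSk : (1 - z ^ 4) * σ T + z ^ 4 * σ (S j) ≤ σ (S k) := by
    linarith [mul_le_mul_of_nonneg_right hexpk (sub_nonneg.mpr hle)]
  have hTbound := mul_le_mul_of_nonneg_left hσT (sub_nonneg.mpr hz₄)
  have hjbound := mul_le_mul_of_nonneg_left hgap (pow_nonneg hz₀ 4)
  have hpoly := mul_le_mul_of_nonneg_right (one_sub_le_two_phase_bound ha hz₀ hz₁) hOPT
  have hz_mul : z ^ 4 * (Real.exp (-(s / b)) * σ Sstar) = a * z ^ 3 * σ Sstar := by
    rw [← hexpj]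
    ring
  linarith [hgreedy k hkn.le]
end

section
/- Let V be a finite type, σ : Finset V → ℝ a monotone submodular set function, b > 0, c : V → ℝ with c(v) > 0 for all v, S ⊆ V, u ∈ V \ S, and S* ⊆ V with c(S*) ≤ b. Suppose that for every v ∈ S* \ S, the greedy ratio condition holds: (σ(S ∪ {u}) − σ(S))/c(u) ≥ (σ(S ∪ {v}) − σ(S))/c(v). Then the single greedy step satisfies σ(S ∪ {u}) − σ(S) ≥ (c(u)/b) · (σ(S*) − σ(S)). (The key per-step recursion in the proof of Lemma 1.) -/
/-- For a set function with diminishing returns, the gain from adding a set `T` disjoint from `S`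
is at most the sum of the marginal gains of its elements at `S`. -/
theorem union_sub_le_sum_marginals {V : Type*} [DecidableEq V] (σ : Finset V → ℝ)
    (hsub : ∀ A B : Finset V, A ⊆ B → ∀ v ∉ B,
      σ (insert v B) - σ B ≤ σ (insert v A) - σ A)
    (S T : Finset V) (hST : Disjoint S T) :
    σ (S ∪ T) - σ S ≤ ∑ v ∈ T, (σ (insert v S) - σ S) := by
  induction T using Finset.induction_on with
  | empty => simp
  | insert a T ha ih =>
    rw [Finset.disjoint_insert_right] at hST
    have hstep := hsub S (S ∪ T) Finset.subset_union_left a (by simp [ha, hST.1])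
    rw [Finset.sum_insert ha, Finset.union_insert]
    linarith [ih hST.2]

/-- Key per-step recursion: if `u` maximizes the marginal-spread-to-cost ratio
over all elements of `S* \ S`, then
`σ(S ∪ {u}) − σ(S) ≥ (c(u)/b)·(σ(S*) − σ(S))`. -/
theorem greedy_step_gain_bound
    {V : Type*} [Fintype V] [DecidableEq V]
    (σ : Finset V → ℝ)
    (hmono : ∀ A B : Finset V, A ⊆ B → σ A ≤ σ B)
    (hsub : ∀ A B : Finset V, A ⊆ B → ∀ v ∉ B,
      σ (insert v B) - σ B ≤ σ (insert v A) - σ A)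
    (b : ℝ) (hb : 0 < b)
    (c : V → ℝ) (hc : ∀ v : V, 0 < c v)
    (S : Finset V) (u : V) (hu : u ∉ S)
    (Sstar : Finset V) (hSstar : ∑ v ∈ Sstar, c v ≤ b)
    (hgreedy : ∀ v ∈ Sstar \ S,
      (σ (insert v S) - σ S) / c v ≤ (σ (insert u S) - σ S) / c u) :
    (c u / b) * (σ Sstar - σ S) ≤ σ (insert u S) - σ S := by
  set g := (σ (insert u S) - σ S) / c u with hg
  have hg0 : 0 ≤ g :=
    div_nonneg (sub_nonneg.2 (hmono _ _ (Finset.subset_insert u S))) (hc u).le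
  have hgain : σ (insert u S) - σ S = c u * g := by
    rw [hg, mul_div_cancel₀ _ (hc u).ne']
  have hcost : ∑ v ∈ Sstar \ S, c v ≤ b :=
    (Finset.sum_le_sum_of_subset_of_nonneg Finset.sdiff_subset
      fun v _ _ => (hc v).le).trans hSstar
  have hbound : σ Sstar - σ S ≤ b * g := calc
    σ Sstar - σ S ≤ σ (S ∪ Sstar \ S) - σ S :=
      sub_le_sub_right (hmono _ _ (by simp)) _
    _ ≤ ∑ v ∈ Sstar \ S, (σ (insert v S) - σ S) :=
      union_sub_le_sum_marginals σ hsub S _ Finset.disjoint_sdiff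
    _ ≤ ∑ v ∈ Sstar \ S, g * c v :=
      Finset.sum_le_sum fun v hv => (div_le_iff₀ (hc v)).1 (hgreedy v hv)
    _ = (∑ v ∈ Sstar \ S, c v) * g := by rw [← Finset.mul_sum, mul_comm]
    _ ≤ b * g := mul_le_mul_of_nonneg_right hcost hg0
  calc c u / b * (σ Sstar - σ S) ≤ c u / b * (b * g) :=
      mul_le_mul_of_nonneg_left hbound (div_pos (hc u) hb).le
    _ = σ (insert u S) - σ S := by
      rw [hgain, ← mul_assoc, div_mul_cancel₀ _ hb.ne']
end

section
/- Let V be a finite type and σ : Finset V → ℝ a monotone submodular set function with σ(∅) = 0. Let S, S* ⊆ V and v ∈ V be such that S* \ S ⊆ {v} and σ({v}) < σ(S*)/2. Then σ(S* ∩ S) ≥ σ(S*)/2, and consequently σ(S) ≥ σ(S*)/2. (Case 2.1 in the proof of Theorem 2: if the optimal set differs from the greedy set by at most one node whose singleton spread is less than half the optimum, the greedy set achieves at least half the optimum.) -/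
/-- Case 2.1 of the proof of Theorem 2: if `S* \ S ⊆ {v}` and `σ({v}) < σ(S*)/2`,
then `σ(S* ∩ S) ≥ σ(S*)/2` and consequently `σ(S) ≥ σ(S*)/2`. -/
theorem greedy_half_opt_of_single_missing_node
    {V : Type*} [Fintype V] [DecidableEq V]
    (σ : Finset V → ℝ)
    (hmono : ∀ A B : Finset V, A ⊆ B → σ A ≤ σ B)
    (hsub : ∀ A B : Finset V, A ⊆ B → ∀ v ∉ B,
      σ (insert v B) - σ B ≤ σ (insert v A) - σ A)
    (hempty : σ ∅ = 0)
    (S Sstar : Finset V) (v : V)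
    (hdiff : Sstar \ S ⊆ {v})
    (hv : σ {v} < σ Sstar / 2) :
    σ Sstar / 2 ≤ σ (Sstar ∩ S) ∧ σ Sstar / 2 ≤ σ S := by
  have hcover : Sstar ⊆ insert v (Sstar ∩ S) := by
    intro x hx
    by_cases hxS : x ∈ S
    · simp [hx, hxS]
    · have := hdiff (Finset.mem_sdiff.mpr ⟨hx, hxS⟩)
      simp_all
  have hle : σ (insert v (Sstar ∩ S)) ≤ σ (Sstar ∩ S) + σ {v} := by
    by_cases hvT : v ∈ Sstar ∩ S
    · rw [Finset.insert_eq_of_mem hvT]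
      linarith [hmono ∅ {v} (Finset.empty_subset _)]
    · have := hsub ∅ (Sstar ∩ S) (Finset.empty_subset _) v hvT
      rw [insert_empty_eq] at this
      linarith
  have hhalf : σ Sstar / 2 ≤ σ (Sstar ∩ S) := by
    linarith [hmono _ _ hcover]
  exact ⟨hhalf, hhalf.trans (hmono _ _ Finset.inter_subset_right)⟩
end

section
/- Let b > 0, let i be a positive integer, and let c₁, …, c_i be real numbers with 0 < c_k ≤ b for each k and ∑_{k=1}^{i} c_k ≥ b/2. Then 1 − ∏_{k=1}^{i} (1 − c_k/b) ≥ 1 − 1/√e. (The combined Case 2.2 estimate in the proof of Theorem 2: when the greedy set has used at least half the budget, the Lemma 1 factor is at least 1 − 1/√e.) -/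
/-- If the costs `c₁, …, c_i` satisfy `0 < c_k ≤ b` and sum to at least `b/2`,
then `1 − ∏ (1 − c_k/b) ≥ 1 − 1/√e`. -/
theorem one_sub_prod_ge_one_sub_inv_sqrt_e
    (b : ℝ) (hb : 0 < b) (i : ℕ) (hi : 0 < i)
    (c : ℕ → ℝ) (hc : ∀ k < i, 0 < c k ∧ c k ≤ b)
    (hsum : b / 2 ≤ ∑ k ∈ Finset.range i, c k) :
    1 - Real.exp (-(1 / 2 : ℝ)) ≤ 1 - ∏ k ∈ Finset.range i, (1 - c k / b) := by
  refine sub_le_sub_left ?_ 1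
  calc ∏ k ∈ Finset.range i, (1 - c k / b)
      ≤ ∏ k ∈ Finset.range i, Real.exp (-(c k / b)) := by
        refine Finset.prod_le_prod (fun k hk => ?_) fun k _ => Real.one_sub_le_exp_neg _
        exact sub_nonneg.2 ((div_le_one hb).2 (hc k (Finset.mem_range.1 hk)).2)
    _ = Real.exp (-((∑ k ∈ Finset.range i, c k) / b)) := by
        rw [← Real.exp_sum, Finset.sum_neg_distrib, Finset.sum_div]
    _ ≤ Real.exp (-(1 / 2 : ℝ)) := by
        refine Real.exp_le_exp.2 (neg_le_neg ?_)
        rw [le_div_iff₀ hb]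
        linarith
end

section
/- Let V be a finite type and G a binary relation on V (the edge relation of a directed graph). For a subrelation H of G (H u v → G u v) and a finite seed set S ⊆ V, let reach_H(S) = {w ∈ V : ∃ s ∈ S, (s, w) is in the reflexive-transitive closure of H}. Suppose u, v ∈ V are such that no vertex of V is G-reachable from both u and v, i.e., reach_G({u}) ∩ reach_G({v}) = ∅. Then for every seed set S ⊆ V and every subrelation H of G: |reach_H(S ∪ {u, v})| − |reach_H(S ∪ {u})| = |reach_H(S ∪ {v})| − |reach_H(S)|. (The per-realization form of Proposition 2: if the influence regions of u and v are disjoint, adding u to the seed set does not change the spread increment of v.) -/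
/-- Per-realization form of Proposition 2: if no vertex of the graph `G` is
reachable from both `u` and `v`, then in every realization (subrelation)
`H` of `G` and for every seed set `S`, adding `u` to the seed set does not
change the spread increment of `v`, measured as the number of reachable
vertices. -/
theorem reach_increment_local
    {V : Type*} [Fintype V] [DecidableEq V]
    (G H : V → V → Prop) (hHG : ∀ a b : V, H a b → G a b)
    (u v : V)
    (hdisj : ∀ w : V,
      ¬ (Relation.ReflTransGen G u w ∧ Relation.ReflTransGen G v w))
    (S : Finset V) :
    (({w : V | ∃ s ∈ insert u (insert v S), Relation.ReflTransGen H s w}.ncard : ℤ)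
        - ({w : V | ∃ s ∈ insert u S, Relation.ReflTransGen H s w}.ncard : ℤ))
      = (({w : V | ∃ s ∈ insert v S, Relation.ReflTransGen H s w}.ncard : ℤ)
        - ({w : V | ∃ s ∈ S, Relation.ReflTransGen H s w}.ncard : ℤ)) := by
  have hunion : {w : V | ∃ s ∈ insert u (insert v S), Relation.ReflTransGen H s w} =
      {w : V | ∃ s ∈ insert u S, Relation.ReflTransGen H s w} ∪
        {w : V | ∃ s ∈ insert v S, Relation.ReflTransGen H s w} := by
    ext w
    simp only [Set.mem_ofPred_eq, Set.mem_union, Finset.exists_mem_insert]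
    tauto
  have hinter : {w : V | ∃ s ∈ S, Relation.ReflTransGen H s w} =
      {w : V | ∃ s ∈ insert u S, Relation.ReflTransGen H s w} ∩
        {w : V | ∃ s ∈ insert v S, Relation.ReflTransGen H s w} := by
    ext w
    have hw : ¬ (Relation.ReflTransGen H u w ∧ Relation.ReflTransGen H v w) :=
      fun h => hdisj w
        ⟨Relation.ReflTransGen.mono hHG _ _ h.1, Relation.ReflTransGen.mono hHG _ _ h.2⟩
    simp only [Set.mem_ofPred_eq, Set.mem_inter_iff, Finset.exists_mem_insert]
    tauto
  have hcard := Set.ncard_union_add_ncard_inter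
    {w : V | ∃ s ∈ insert u S, Relation.ReflTransGen H s w}
    {w : V | ∃ s ∈ insert v S, Relation.ReflTransGen H s w}
  rw [← hunion, ← hinter] at hcard
  omega
end

section
/- Let V be a finite type, G a binary relation on V, and μ a finitely supported probability distribution (PMF) on subrelations of G, represented as a PMF on the finite set of edge subsets H ⊆ {(a,b) : G a b}. Define the influence spread σ(S) = E_{H ∼ μ}[|reach_H(S)|], where reach_H(S) = {w ∈ V : ∃ s ∈ S, (s, w) is in the reflexive-transitive closure of H}. Suppose u, v ∈ V satisfy reach_G({u}) ∩ reach_G({v}) = ∅ (no vertex is G-reachable from both u and v). Then for every seed set S ⊆ V: σ(S ∪ {u, v}) − σ(S ∪ {u}) = σ(S ∪ {v}) − σ(S). (Proposition 2: adding u to the seed set does not change the spread increment of v when their influence regions are vertex-disjoint.) -/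
theorem Set.ncard_union_union_add_ncard_of_disjoint {α : Type*} [Finite α]
    {A B : Set α} (h : Disjoint A B) (R : Set α) :
    (A ∪ (B ∪ R)).ncard + R.ncard = (A ∪ R).ncard + (B ∪ R).ncard := by
  have hinter : (A ∪ R) ∩ (B ∪ R) = R := by
    rw [← Set.inter_union_distrib_right, h.inter_eq, Set.empty_union]
  have hunion : (A ∪ R) ∪ (B ∪ R) = A ∪ (B ∪ R) := by
    rw [← Set.union_union_distrib_right, Set.union_assoc]
  have hcard := Set.ncard_union_add_ncard_inter (A ∪ R) (B ∪ R)
  rwa [hinter, hunion] at hcard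

theorem Relation.setOf_exists_mem_insert_reflTransGen {V : Type*} [DecidableEq V]
    (r : V → V → Prop) (a : V) (S : Finset V) :
    {w | ∃ s ∈ insert a S, Relation.ReflTransGen r s w} =
      {w | Relation.ReflTransGen r a w} ∪
        {w | ∃ s ∈ S, Relation.ReflTransGen r s w} := by
  ext w
  simp


/-- Proposition 2: in the live-edge model, where a random subrelation `H` of the
graph `G` is drawn from a PMF `μ` and the influence spread `σ(S)` is the
expected number of vertices reachable from the seed set `S`, if no vertex is
`G`-reachable from both `u` and `v` then adding `u` to the seed set does not
change the spread increment of `v`. -/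
theorem spread_increment_local
    {V : Type*} [Fintype V] [DecidableEq V]
    (G : V → V → Prop)
    (μ : PMF {H : V → V → Bool // ∀ a b : V, H a b = true → G a b})
    (σ : Finset V → ℝ)
    (hσ : ∀ S : Finset V,
      σ S = ∑' H : {H : V → V → Bool // ∀ a b : V, H a b = true → G a b},
        (μ H).toReal *
          (({w : V | ∃ s ∈ S,
              Relation.ReflTransGen (fun a b => H.1 a b = true) s w}.ncard : ℝ)))
    (u v : V)
    (hdisj : ∀ w : V,
      ¬ (Relation.ReflTransGen G u w ∧ Relation.ReflTransGen G v w))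
    (S : Finset V) :
    σ (insert u (insert v S)) - σ (insert u S) = σ (insert v S) - σ S := by
  have hsum : ∀ f : {H : V → V → Bool // ∀ a b : V, H a b = true → G a b} → ℝ,
      Summable f := fun _ => Summable.of_finite
  suffices h : σ (insert u (insert v S)) + σ S = σ (insert u S) + σ (insert v S) by
    linarith
  simp only [hσ]
  rw [← (hsum _).tsum_add (hsum _), ← (hsum _).tsum_add (hsum _)]
  refine tsum_congr fun H => ?_
  have hdisjH : Disjoint {w | Relation.ReflTransGen (fun a b => H.1 a b = true) u w}
      {w | Relation.ReflTransGen (fun a b => H.1 a b = true) v w} :=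
    Set.disjoint_left.2 fun w hu hv =>
      hdisj w ⟨Relation.ReflTransGen.mono H.2 _ _ hu, Relation.ReflTransGen.mono H.2 _ _ hv⟩
  rw [← mul_add, ← mul_add]
  congr 1
  simp only [Relation.setOf_exists_mem_insert_reflTransGen]
  exact_mod_cast Set.ncard_union_union_add_ncard_of_disjoint hdisjH _
end

section
/- Let G = (V, E) be a finite directed acyclic graph that is singly-connected: for every ordered pair of vertices (a, b) there is at most one directed path from a to b. Let p : E → [0, 1] assign a propagation probability to each edge, and let the edges be live independently: the realization ω : E → Bool is drawn from the product of Bernoulli(p(e)) distributions. Fix a seed set S ⊆ V, and say a vertex w is active in realization ω if w ∈ S or there exist s ∈ S and a directed path from s to w all of whose edges are live in ω. Let q(w) denote the probability that w is active. Then q(w) = 1 for every w ∈ S, and for every w ∉ S: q(w) = 1 − ∏_{u : (u,w) ∈ E} (1 − q(u) · p(u, w)). (The exactness of the Single-Pass Belief Propagation recursion on singly-connected DAGs, claimed in Section IV-C.) -/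
open Relation

/-- Expectation of `f` at a random subset of `E` that contains each `e ∈ E` independently with
probability `p e`. -/
noncomputable def subsetExp {α : Type*} [DecidableEq α] (p : α → ℝ) (E : Finset α)
    (f : Finset α → ℝ) : ℝ :=
  ∑ T ∈ E.powerset, (∏ e ∈ T, p e) * (∏ e ∈ E \ T, (1 - p e)) * f T

section subsetExp

variable {α : Type*} [DecidableEq α] {p : α → ℝ} {E : Finset α}

theorem subsetExp_congr {f g : Finset α → ℝ} (h : ∀ T ⊆ E, f T = g T) :
    subsetExp p E f = subsetExp p E g :=
  Finset.sum_congr rfl fun T hT => by rw [h T (Finset.mem_powerset.1 hT)]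

theorem subsetExp_insert {e : α} (he : e ∉ E) (f : Finset α → ℝ) :
    subsetExp p (insert e E) f =
      (1 - p e) * subsetExp p E f + p e * subsetExp p E fun T => f (insert e T) := by
  unfold subsetExp
  rw [Finset.sum_powerset_insert he, Finset.mul_sum, Finset.mul_sum]
  congr 1 <;> refine Finset.sum_congr rfl fun T hT => ?_
  · have heT : e ∉ T := fun h => he (Finset.mem_powerset.1 hT h)
    rw [Finset.insert_sdiff_of_notMem _ heT, Finset.prod_insert (by simp [he])]
    ring
  · have heT : e ∉ T := fun h => he (Finset.mem_powerset.1 hT h)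
    rw [Finset.prod_insert heT, Finset.insert_sdiff_insert, Finset.sdiff_insert_of_notMem he]
    ring

theorem subsetExp_const (c : ℝ) : subsetExp p E (fun _ => c) = c := by
  induction E using Finset.induction_on with
  | empty => simp [subsetExp]
  | insert e E he ih => rw [subsetExp_insert he, ih]; ring

theorem subsetExp_sub (f g : Finset α → ℝ) :
    subsetExp p E (fun T => f T - g T) = subsetExp p E f - subsetExp p E g := by
  simp only [subsetExp, mul_sub, Finset.sum_sub_distrib]

theorem subsetExp_mem {e : α} (he : e ∈ E) :
    subsetExp p E (fun T => if e ∈ T then 1 else 0) = p e := by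
  rw [← Finset.insert_erase he, subsetExp_insert (Finset.notMem_erase e E),
    subsetExp_congr (g := fun _ => 0) fun T hT =>
      if_neg fun h => Finset.notMem_erase e E (hT h)]
  simp [subsetExp_const]

/-- Two random variables are uncorrelated when no element of `E` influences both. -/
theorem subsetExp_mul {f g : Finset α → ℝ}
    (h : ∀ e ∈ E, (∀ T ⊆ E, f (insert e T) = f T) ∨ ∀ T ⊆ E, g (insert e T) = g T) :
    subsetExp p E (fun T => f T * g T) = subsetExp p E f * subsetExp p E g := by
  induction E using Finset.induction_on generalizing f g with
  | empty => simp [subsetExp]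
  | insert e E he ih =>
    have hsub : E ⊆ insert e E := Finset.subset_insert e E
    have key : ∀ f' g' : Finset α → ℝ,
        (f' = f ∨ f' = fun T => f (insert e T)) → (g' = g ∨ g' = fun T => g (insert e T)) →
        subsetExp p E (fun T => f' T * g' T) = subsetExp p E f' * subsetExp p E g' := by
      intro f' g' hf hg
      refine ih fun a ha => (h a (hsub ha)).imp (fun H T hT => ?_) (fun H T hT => ?_)
      · rcases hf with rfl | rfl
        · exact H T (hT.trans hsub)
        · simpa only [Finset.insert_comm e a] using H _ (Finset.insert_subset_insert e hT)
      · rcases hg with rfl | rfl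
        · exact H T (hT.trans hsub)
        · simpa only [Finset.insert_comm e a] using H _ (Finset.insert_subset_insert e hT)
    rw [subsetExp_insert he, subsetExp_insert he, subsetExp_insert he,
      key f g (.inl rfl) (.inl rfl), key _ _ (.inr rfl) (.inr rfl)]
    rcases h e (Finset.mem_insert_self e E) with H | H
    · rw [subsetExp_congr fun T hT => H T (hT.trans hsub)]
      ring
    · rw [subsetExp_congr (f := fun T => g (insert e T)) fun T hT => H T (hT.trans hsub)]
      ring

theorem subsetExp_prod {ι : Type*} {I : Finset ι} {f : ι → Finset α → ℝ}
    (h : ∀ e ∈ E, ∀ i ∈ I, ∀ j ∈ I, i ≠ j →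
      (∀ T ⊆ E, f i (insert e T) = f i T) ∨ ∀ T ⊆ E, f j (insert e T) = f j T) :
    subsetExp p E (fun T => ∏ i ∈ I, f i T) = ∏ i ∈ I, subsetExp p E (f i) := by
  classical
  induction I using Finset.induction_on with
  | empty => simp [subsetExp_const]
  | insert j I hj ih =>
    simp only [Finset.prod_insert hj]
    rw [subsetExp_mul, ih fun e he i hi k hk =>
      h e he i (Finset.mem_insert_of_mem hi) k (Finset.mem_insert_of_mem hk)]
    intro e he
    by_cases H : ∀ T ⊆ E, f j (insert e T) = f j T
    · exact .inl H
    · refine .inr fun T hT => Finset.prod_congr rfl fun i hi => ?_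
      exact (h e he j (Finset.mem_insert_self j I) i (Finset.mem_insert_of_mem hi)
        (fun hji => hj (hji ▸ hi))).resolve_left H T hT

end subsetExp

/-- `w` is reachable from `S` along edges in `T`. -/
def ReachableFrom {V : Type*} (S : Finset V) (T : Finset (V × V)) (w : V) : Prop :=
  ∃ s ∈ S, ReflTransGen (fun a b => (a, b) ∈ T) s w

section reachability

variable {V : Type*} {S : Finset V} {E T : Finset (V × V)}

theorem reachableFrom_iff_exists_edge {w : V} (hw : w ∉ S) :
    ReachableFrom S T w ↔ ∃ u, ReachableFrom S T u ∧ (u, w) ∈ T := by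
  constructor
  · rintro ⟨s, hs, h⟩
    rcases h.cases_tail with rfl | ⟨u, hu, huw⟩
    · exact absurd hs hw
    · exact ⟨u, ⟨s, hs, hu⟩, huw⟩
  · rintro ⟨u, ⟨s, hs, hu⟩, huw⟩
    exact ⟨s, hs, hu.tail huw⟩

theorem reachableFrom_insert_iff [DecidableEq V] {a b u : V} (hT : T ⊆ E)
    (h : ¬ ReflTransGen (fun x y => (x, y) ∈ E) b u) :
    ReachableFrom S (insert (a, b) T) u ↔ ReachableFrom S T u := by
  refine exists_congr fun s => and_congr_right' ⟨fun hs => ?_, fun hs =>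
    ReflTransGen.mono (fun x y hxy => Finset.mem_insert_of_mem hxy) s u hs⟩
  induction hs using ReflTransGen.head_induction_on with
  | refl => exact .refl
  | head hxy _ ih =>
    rcases Finset.mem_insert.1 hxy with heq | hmem
    · obtain ⟨-, rfl⟩ := Prod.mk.inj heq
      exact absurd (ReflTransGen.mono (fun x y hxy => hT hxy) _ _ ih) h
    · exact ih.head hmem

/-- If directed paths are unique, a vertex reaches `w` through at most one in-neighbour of `w`. -/
theorem in_neighbor_unique
    (hsingly : ∀ (a b : V) (l₁ l₂ : List V),
      (l₁.IsChain (fun x y => (x, y) ∈ E) ∧ l₁.head? = some a ∧ l₁.getLast? = some b) →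
      (l₂.IsChain (fun x y => (x, y) ∈ E) ∧ l₂.head? = some a ∧ l₂.getLast? = some b) →
      l₁ = l₂)
    {b u v w : V} (hu : ReflTransGen (fun x y => (x, y) ∈ E) b u)
    (hv : ReflTransGen (fun x y => (x, y) ∈ E) b v) (huw : (u, w) ∈ E) (hvw : (v, w) ∈ E) :
    u = v := by
  have path : ∀ x, ReflTransGen (fun x y => (x, y) ∈ E) b x → (x, w) ∈ E →
      ∃ l : List V, l.getLast? = some x ∧ (l ++ [w]).IsChain (fun x y => (x, y) ∈ E) ∧
        (l ++ [w]).head? = some b ∧ (l ++ [w]).getLast? = some w := by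
    intro x hx hxw
    obtain ⟨l, hl, hlast⟩ := List.exists_isChain_cons_of_relationReflTransGen hx
    have hlast' : (b :: l).getLast? = some x := by
      rw [List.getLast?_eq_some_getLast (List.cons_ne_nil _ _), hlast]
    refine ⟨b :: l, hlast', ?_, by simp, List.getLast?_concat⟩
    refine hl.append (List.isChain_singleton w) fun y hy z hz => ?_
    rw [hlast'] at hy
    simp only [List.head?_cons, Option.mem_def, Option.some.injEq] at hy hz
    exact hy ▸ hz ▸ hxw
  obtain ⟨l₁, h₁, hl₁⟩ := path u hu huw
  obtain ⟨l₂, h₂, hl₂⟩ := path v hv hvw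
  have := List.append_cancel_right (hsingly b w _ _ hl₁ hl₂)
  subst this
  exact Option.some.inj (h₁.symm.trans h₂)

end reachability


open Classical in
/-- Exactness of the Single-Pass Belief Propagation recursion on
singly-connected DAGs.  The graph has edge set `E ⊆ V × V`; it is acyclic and
singly-connected (for every ordered pair of vertices there is at most one
directed path, a path being recorded as the list of its vertices).  Each edge
`e` is live independently with probability `p e`, so a realization is a subset
`T ⊆ E` of live edges, drawn with probability `∏_{e∈T} p e · ∏_{e∈E\T} (1−p e)`.
A vertex `w` is active in realization `T` iff there is a (possibly empty)
directed path of live edges from some seed `s ∈ S` to `w`, and `q w` is the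
probability that `w` is active.  Then `q w = 1` on seeds, and for non-seeds
`q w = 1 − ∏_{u : (u,w) ∈ E} (1 − q u · p (u,w))`. -/
theorem spbp_exact_on_singly_connected_dag
    {V : Type*} [Fintype V] [DecidableEq V]
    (E : Finset (V × V))
    (hacyclic : ∀ x : V, ¬ Relation.TransGen (fun a b => (a, b) ∈ E) x x)
    (hsingly : ∀ (a b : V) (l₁ l₂ : List V),
      (l₁.Chain' (fun x y => (x, y) ∈ E) ∧ l₁.head? = some a ∧ l₁.getLast? = some b) →
      (l₂.Chain' (fun x y => (x, y) ∈ E) ∧ l₂.head? = some a ∧ l₂.getLast? = some b) →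
      l₁ = l₂)
    (p : V × V → ℝ) (hp : ∀ e ∈ E, 0 ≤ p e ∧ p e ≤ 1)
    (S : Finset V)
    (q : V → ℝ)
    (hq : ∀ w : V, q w = ∑ T ∈ E.powerset,
      (∏ e ∈ T, p e) * (∏ e ∈ E \ T, (1 - p e)) *
        (if ∃ s ∈ S, Relation.ReflTransGen (fun a b => (a, b) ∈ T) s w
         then 1 else 0)) :
    (∀ w ∈ S, q w = 1) ∧
    (∀ w ∉ S, q w =
      1 - ∏ x ∈ Finset.univ.filter (fun x : V => (x, w) ∈ E),
            (1 - q x * p (x, w))) := by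
  classical
  have hq' : ∀ w, q w = subsetExp p E fun T => if ReachableFrom S T w then 1 else 0 := by
    intro w
    rw [hq w]
    unfold subsetExp ReachableFrom
    congr!
  refine ⟨fun w hw => ?_, fun w hw => ?_⟩
  · rw [hq', subsetExp_congr (g := fun _ => 1) fun T _ => if_pos ⟨w, hw, .refl⟩, subsetExp_const]
  have no_return : ∀ u, (u, w) ∈ E → ¬ ReflTransGen (fun a b => (a, b) ∈ E) w u :=
    fun u huw h => hacyclic w (TransGen.tail' h huw)
  have factor : ∀ u, (u, w) ∈ E → subsetExp p E (fun T =>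
      1 - (if ReachableFrom S T u then 1 else 0) * (if (u, w) ∈ T then 1 else 0)) =
      1 - q u * p (u, w) := by
    intro u huw
    rw [subsetExp_sub, subsetExp_const, subsetExp_mul, subsetExp_mem huw, hq']
    rintro ⟨a, b⟩ -
    by_cases hb : b = w
    · refine .inl fun T hT => ?_
      simp only [reachableFrom_insert_iff hT (hb ▸ no_return u huw)]
    · refine .inr fun T _ => ?_
      simp [Ne.symm hb]
  have unaffected : ∀ a b u, (u, w) ∈ E → ¬ ReflTransGen (fun x y => (x, y) ∈ E) b u →
      (u, w) ≠ (a, b) → ∀ T ⊆ E,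
      (1 - (if ReachableFrom S (insert (a, b) T) u then 1 else 0) *
        (if (u, w) ∈ insert (a, b) T then 1 else 0) : ℝ) =
      1 - (if ReachableFrom S T u then 1 else 0) * (if (u, w) ∈ T then 1 else 0) := by
    intro a b u _ hbu hne T hT
    simp only [reachableFrom_insert_iff hT hbu, Finset.mem_insert, hne, false_or]
  rw [← Finset.prod_congr rfl fun u hu => factor u (by simpa using hu), ← subsetExp_prod]
  · have hcompl := subsetExp_sub (p := p) (E := E) (fun _ => 1)
      fun T => if ReachableFrom S T w then 1 else 0
    rw [subsetExp_const, ← hq'] at hcompl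
    rw [eq_sub_iff_add_eq, ← eq_sub_iff_add_eq', ← hcompl]
    refine subsetExp_congr fun T hT => ?_
    by_cases hact : ReachableFrom S T w
    · obtain ⟨u, hu, huw⟩ := (reachableFrom_iff_exists_edge hw).1 hact
      rw [if_pos hact, Finset.prod_eq_zero (i := u) (by simpa using hT huw) (by simp [hu, huw])]
      simp
    · rw [if_neg hact, sub_zero]
      refine Finset.prod_eq_one fun u _ => ?_
      by_cases hu : ReachableFrom S T u
      · have huw : (u, w) ∉ T := fun h =>
          hact ((reachableFrom_iff_exists_edge hw).2 ⟨u, hu, h⟩)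
        simp [huw]
      · simp [hu]
  · rintro ⟨a, b⟩ - u hu v hv huv
    have huw : (u, w) ∈ E := by simpa using hu
    have hvw : (v, w) ∈ E := by simpa using hv
    by_cases hb : b = w
    · subst hb
      by_cases ha : a = u
      · exact .inr (unaffected a b v hvw (no_return v hvw) (by simp [ha, huv.symm]))
      · exact .inl (unaffected a b u huw (no_return u huw) (by simp [Ne.symm ha]))
    · by_cases hbu : ReflTransGen (fun x y => (x, y) ∈ E) b u
      · exact .inr (unaffected a b v hvw
          (fun hbv => huv (in_neighbor_unique hsingly hbu hbv huw hvw)) (by simp [Ne.symm hb]))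
      · exact .inl (unaffected a b u huw hbu (by simp [Ne.symm hb]))
end
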